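/- arXiv:2011.12812 — 3 statements merged into one kernel-verified Lean document; each statement's English description precedes it below -/
import Mathlib

section
/- Let n ≥ 1, let W₁, …, Wₙ : [0, ∞) → [0, ∞) be continuous, and let f : [0, ∞) → [0, ∞) be locally integrable. Suppose v₁, …, vₙ : [0, ∞) → ℝ are continuous and satisfy v₁(t) = ∫₀ᵗ (-W₁(s)v₁(s) - f(s)) ds and v_j(t) = ∫₀ᵗ (-W_j(s)v_j(s) + W_{j-1}(s)v_{j-1}(s)) ds for 2 ≤ j ≤ n and all t ≥ 0 (so v_j(0) = 0 for all j). Then for all j and all t ≥ 0: 0 ≤ -v_j(t) ≤ ∫₀ᵗ f(s) ds; moreover 0 ≥ ∫₀ᵗ Wₙ(s)vₙ(s) ds ≥ ∫₀ᵗ W_{n-1}(s)v_{n-1}(s) ds ≥ ⋯ ≥ ∫₀ᵗ W₁(s)v₁(s) ds ≥ -∫₀ᵗ f(s) ds. -/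
/-- Predecessor index in `Fin n` (clamped at `0`). -/
def fpred {n : ℕ} (j : Fin n) : Fin n := ⟨j.1 - 1, lt_of_le_of_lt (Nat.sub_le j.1 1) j.2⟩

theorem aux_int {g : ℝ → ℝ} (hg : ContinuousOn g (Set.Ici 0)) {a b : ℝ} (ha : 0 ≤ a)
    (hb : 0 ≤ b) : IntervalIntegrable g MeasureTheory.volume a b := by
  apply ContinuousOn.intervalIntegrable
  apply hg.mono
  intro x hx
  exact le_trans (le_min ha hb) hx.1

theorem aux_nonpos {w U g : ℝ → ℝ} (hw : ContinuousOn w (Set.Ici 0))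
    (hU : ContinuousOn U (Set.Ici 0)) (hUpos : ∀ s : ℝ, 0 ≤ s → 0 ≤ U s)
    (hg : ∀ s : ℝ, 0 ≤ s → g s ≤ 0)
    (hgi : ∀ a b : ℝ, 0 ≤ a → 0 ≤ b → IntervalIntegrable g MeasureTheory.volume a b)
    (heq : ∀ t : ℝ, 0 ≤ t → w t = ∫ s in (0:ℝ)..t, (-(U s * w s) + g s))
    (t : ℝ) (ht : 0 ≤ t) : w t ≤ 0 := by
  by_contra hpos
  have hc : ContinuousOn w (Set.Icc 0 t) := hw.mono (fun x hx => hx.1)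
  have hcl : IsClosed (Set.Icc 0 t ∩ w ⁻¹' Set.Iic 0) :=
    hc.preimage_isClosed_of_isClosed isClosed_Icc isClosed_Iic
  have hcomp : IsCompact (Set.Icc 0 t ∩ w ⁻¹' Set.Iic 0) :=
    isCompact_Icc.of_isClosed_subset hcl Set.inter_subset_left
  have hne : (Set.Icc 0 t ∩ w ⁻¹' Set.Iic 0).Nonempty := by
    refine ⟨0, ⟨le_refl _, ht⟩, ?_⟩
    have := heq 0 le_rfl
    simp at this
    simp [this]
  obtain ⟨a, ⟨⟨ha0, hat⟩, haw⟩, hmax⟩ := hcomp.exists_isGreatest hne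
  have haw' : w a ≤ 0 := haw
  have hi : ∀ a b : ℝ, 0 ≤ a → 0 ≤ b →
      IntervalIntegrable (fun s => -(U s * w s) + g s) MeasureTheory.volume a b :=
    fun a b ha hb => (aux_int (hU.mul hw).neg ha hb).add (hgi a b ha hb)
  have hsplit := intervalIntegral.integral_add_adjacent_intervals
    (hi 0 a le_rfl ha0) (hi a t ha0 ht)
  rw [← heq a ha0, ← heq t ht] at hsplit
  have hle : ∫ s in a..t, (-(U s * w s) + g s) ≤ ∫ s in a..t, (0:ℝ) := by
    apply intervalIntegral.integral_mono_on_of_le_Ioo hat (hi a t ha0 ht) (by simp)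
    intro x hx
    have hx0 : 0 ≤ x := ha0.trans hx.1.le
    have hwx : 0 ≤ w x := by
      by_contra hneg
      have : x ≤ a := hmax ⟨⟨hx0, hx.2.le⟩, (not_le.mp hneg).le⟩
      linarith [hx.1]
    have := mul_nonneg (hUpos x hx0) hwx
    linarith [hg x hx0]
  simp only [intervalIntegral.integral_zero] at hle
  linarith

/-- positivity preservation and a priori bounds for the triangular
inhomogeneous linear system, in integral form. -/
theorem stmt_4 (n : ℕ) (hn : 1 ≤ n) (W v : Fin n → ℝ → ℝ) (f : ℝ → ℝ)
    (hW : ∀ j, ContinuousOn (W j) (Set.Ici 0))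
    (hWpos : ∀ j, ∀ s : ℝ, 0 ≤ s → 0 ≤ W j s)
    (hfpos : ∀ s : ℝ, 0 ≤ s → 0 ≤ f s)
    (hfint : MeasureTheory.LocallyIntegrableOn f (Set.Ici 0))
    (hv : ∀ j, ContinuousOn (v j) (Set.Ici 0))
    (hv1 : ∀ t : ℝ, 0 ≤ t →
      v ⟨0, hn⟩ t = ∫ s in (0:ℝ)..t, (-(W ⟨0, hn⟩ s * v ⟨0, hn⟩ s) - f s))
    (hvj : ∀ j : Fin n, j.1 ≠ 0 → ∀ t : ℝ, 0 ≤ t →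
      v j t = ∫ s in (0:ℝ)..t, (-(W j s * v j s) + W (fpred j) s * v (fpred j) s)) :
    ∀ t : ℝ, 0 ≤ t →
      (∀ j : Fin n, 0 ≤ -(v j t) ∧ -(v j t) ≤ ∫ s in (0:ℝ)..t, f s) ∧
      (∫ s in (0:ℝ)..t, W ⟨n - 1, by omega⟩ s * v ⟨n - 1, by omega⟩ s) ≤ 0 ∧
      (∀ j : Fin n, j.1 ≠ 0 →
        (∫ s in (0:ℝ)..t, W (fpred j) s * v (fpred j) s)
          ≤ ∫ s in (0:ℝ)..t, W j s * v j s) ∧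
      -(∫ s in (0:ℝ)..t, f s) ≤ ∫ s in (0:ℝ)..t, W ⟨0, hn⟩ s * v ⟨0, hn⟩ s := by
  have hfi : ∀ a b : ℝ, 0 ≤ a → 0 ≤ b → IntervalIntegrable f MeasureTheory.volume a b := by
    intro a b ha hb
    rw [intervalIntegrable_iff']
    apply hfint.integrableOn_compact_subset _ isCompact_uIcc
    intro x hx
    exact le_trans (le_min ha hb) hx.1
  have hWv : ∀ j, ContinuousOn (fun s => W j s * v j s) (Set.Ici 0) := fun j => (hW j).mul (hv j)
  have hneg : ∀ k : ℕ, ∀ hk : k < n, ∀ t : ℝ, 0 ≤ t → v ⟨k, hk⟩ t ≤ 0 := by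
    intro k
    induction k with
    | zero =>
      intro hk
      refine aux_nonpos (hv _) (hW ⟨0, hn⟩) (hWpos ⟨0, hn⟩) (g := fun s => - f s)
        (fun s hs => by linarith [hfpos s hs]) (fun a b ha hb => (hfi a b ha hb).neg) ?_
      intro t ht
      rw [hv1 t ht]
      simp only [sub_eq_add_neg]
    | succ k ih =>
      intro hk
      refine aux_nonpos (hv _) (hW ⟨k+1, hk⟩) (hWpos ⟨k+1, hk⟩)
        (g := fun s => W (fpred ⟨k+1, hk⟩) s * v (fpred ⟨k+1, hk⟩) s)
        (fun s hs => mul_nonpos_of_nonneg_of_nonpos (hWpos _ s hs) (ih (by omega) s hs))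
        (fun a b ha hb => aux_int (hWv _) ha hb) ?_
      exact hvj ⟨k+1, hk⟩ (by simp)
  have hI : ∀ j : Fin n, ∀ t : ℝ, 0 ≤ t → (∫ s in (0:ℝ)..t, W j s * v j s) ≤ 0 := by
    intro j t ht
    have := intervalIntegral.integral_mono_on ht (aux_int (hWv j) le_rfl ht)
      (intervalIntegrable_const (c := (0:ℝ)))
      (fun s hs => mul_nonpos_of_nonneg_of_nonpos (hWpos j s hs.1) (hneg j.1 j.2 s hs.1))
    simpa using this
  intro t ht
  have hWn : ∀ j, IntervalIntegrable (fun s => -(W j s * v j s)) MeasureTheory.volume 0 t :=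
    fun j => aux_int (hWv j).neg le_rfl ht
  have e1 : v ⟨0, hn⟩ t = -(∫ s in (0:ℝ)..t, W ⟨0, hn⟩ s * v ⟨0, hn⟩ s)
      - ∫ s in (0:ℝ)..t, f s := by
    rw [hv1 t ht, intervalIntegral.integral_sub (hWn _)
      (hfi 0 t le_rfl ht), intervalIntegral.integral_neg]
  have ej : ∀ j : Fin n, j.1 ≠ 0 → v j t = -(∫ s in (0:ℝ)..t, W j s * v j s)
      + ∫ s in (0:ℝ)..t, W (fpred j) s * v (fpred j) s := by
    intro j hj
    rw [hvj j hj t ht, intervalIntegral.integral_add (hWn _)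
      (aux_int (hWv _) le_rfl ht), intervalIntegral.integral_neg]
  have hlow : ∀ k : ℕ, ∀ hk : k < n, -(∫ s in (0:ℝ)..t, f s)
      ≤ ∫ s in (0:ℝ)..t, W ⟨k, hk⟩ s * v ⟨k, hk⟩ s := by
    intro k
    induction k with
    | zero =>
      intro hk
      linarith [hneg 0 hk t ht]
    | succ k ih =>
      intro hk
      have h1 := ej ⟨k+1, hk⟩ (by simp)
      have h2 : -(∫ s in (0:ℝ)..t, f s) ≤ ∫ s in (0:ℝ)..t,
        W (fpred ⟨k+1, hk⟩) s * v (fpred ⟨k+1, hk⟩) s := ih (by omega)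
      linarith [hneg (k+1) hk t ht]
  refine ⟨?_, hI _ t ht, ?_, hlow 0 hn⟩
  · intro j
    refine ⟨by linarith [hneg j.1 j.2 t ht], ?_⟩
    by_cases hj : j.1 = 0
    · have : j = ⟨0, hn⟩ := Fin.ext hj
      subst this
      linarith [hI ⟨0, hn⟩ t ht]
    · have h1 := ej j hj
      have h2 := hlow (fpred j).1 (fpred j).2
      simp only [Fin.eta] at h2
      linarith [hI j t ht]
  · intro j hj
    linarith [ej j hj, hneg j.1 j.2 t ht]
end

section
/- Let n ≥ 1 and let W₁, …, Wₙ : [0, ∞) → [0, ∞) be continuous. Suppose v₁, …, vₙ : [0, ∞) → ℝ are continuous and satisfy the homogeneous triangular system v₁(t) = v₁(0) - ∫₀ᵗ W₁(s)v₁(s) ds and v_j(t) = v_j(0) + ∫₀ᵗ (-W_j(s)v_j(s) + W_{j-1}(s)v_{j-1}(s)) ds for 2 ≤ j ≤ n and all t ≥ 0. Then: (i) if v_j(0) ≥ 0 for all j, then v_j(t) ≥ 0 for all j and t, and for every m ≤ n and every t ≥ 0 one has 0 ≤ ∑_{j=1}^m v_j(t) ≤ ∑_{j=1}^m v_j(0)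 and ∫₀ᵗ W_m(s)v_m(s) ds ≤ ∑_{j=1}^m v_j(0); (ii) for arbitrary initial data, |∑_{j=1}^m v_j(t)| ≤ ∑_{j=1}^m |v_j(0)| for every m ≤ n and every t ≥ 0. -/
theorem aux_pos (a b f : ℝ → ℝ) (ha : ContinuousOn a (Set.Ici 0))
    (hb : ContinuousOn b (Set.Ici 0)) (hf : ContinuousOn f (Set.Ici 0))
    (hb0 : ∀ s, 0 ≤ s → 0 ≤ b s) (hf0 : 0 ≤ f 0)
    (h : ∀ t, 0 ≤ t → f t = f 0 + ∫ s in (0:ℝ)..t, (-(a s * f s) + b s)) :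
    ∀ t, 0 ≤ t → 0 ≤ f t := by
  have ext : ∀ g : ℝ → ℝ, ContinuousOn g (Set.Ici 0) → Continuous (fun t => g (max 0 t)) := by
    intro g hg
    exact hg.comp_continuous (by fun_prop) (fun t => by simp)
  have ha' := ext a ha
  have hb' := ext b hb
  have hf' := ext f hf
  set A : ℝ → ℝ := fun t => ∫ s in (0:ℝ)..t, a (max 0 s) with hA
  set F : ℝ → ℝ := fun t => f 0 + ∫ s in (0:ℝ)..t,
    (-(a (max 0 s) * f (max 0 s)) + b (max 0 s)) with hF
  have hAd : ∀ t, HasDerivAt A (a (max 0 t)) t := fun t => ha'.integral_hasStrictDerivAt 0 t |>.hasDerivAt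
  have hFd : ∀ t, HasDerivAt F (-(a (max 0 t) * f (max 0 t)) + b (max 0 t)) t := fun t =>
    (((ha'.mul hf').neg.add hb').integral_hasStrictDerivAt 0 t |>.hasDerivAt).const_add (f 0)
  have hFf : ∀ t, 0 ≤ t → F t = f t := by
    intro t ht
    rw [h t ht, hF]
    simp only
    congr 1
    apply intervalIntegral.integral_congr
    intro s hs
    rw [Set.uIcc_of_le ht] at hs
    simp only [max_eq_right hs.1]
  have hG : ∀ t, HasDerivAt (fun t => F t * Real.exp (A t))
      ((-(a (max 0 t) * f (max 0 t)) + b (max 0 t)) * Real.exp (A t)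
        + F t * (Real.exp (A t) * a (max 0 t))) t := fun t => (hFd t).mul (hAd t).exp
  have hmono : MonotoneOn (fun t => F t * Real.exp (A t)) (Set.Ici 0) := by
    apply monotoneOn_of_deriv_nonneg (convex_Ici 0)
    · exact fun t _ => (hG t).continuousAt.continuousWithinAt
    · exact fun t _ => (hG t).differentiableAt.differentiableWithinAt
    · intro t ht
      rw [interior_Ici] at ht
      have ht : 0 ≤ t := le_of_lt ht
      rw [(hG t).deriv, hFf t ht, max_eq_right ht]
      have := mul_nonneg (hb0 t ht) (Real.exp_pos (A t)).le
      nlinarith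
  intro t ht
  have h1 := hmono (Set.mem_Ici.2 le_rfl) (Set.mem_Ici.2 ht) ht
  simp only [hFf t ht, hFf 0 le_rfl] at h1
  have h2 : 0 ≤ f t * Real.exp (A t) :=
    le_trans (mul_nonneg hf0 (Real.exp_pos _).le) h1
  exact nonneg_of_mul_nonneg_left h2 (Real.exp_pos _)

/-- positivity preservation and ℓ¹-contraction for the homogeneous
triangular linear system, in integral form. -/
theorem stmt_6 (n : ℕ) (hn : 1 ≤ n) (W v : Fin n → ℝ → ℝ)
    (hW : ∀ j, ContinuousOn (W j) (Set.Ici 0))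
    (hWpos : ∀ j, ∀ s : ℝ, 0 ≤ s → 0 ≤ W j s)
    (hv : ∀ j, ContinuousOn (v j) (Set.Ici 0))
    (hv1 : ∀ t : ℝ, 0 ≤ t →
      v ⟨0, hn⟩ t = v ⟨0, hn⟩ 0 - ∫ s in (0:ℝ)..t, W ⟨0, hn⟩ s * v ⟨0, hn⟩ s)
    (hvj : ∀ j : Fin n, j.1 ≠ 0 → ∀ t : ℝ, 0 ≤ t →
      v j t = v j 0 + ∫ s in (0:ℝ)..t, (-(W j s * v j s) + W (fpred j) s * v (fpred j) s)) :
    ((∀ j : Fin n, 0 ≤ v j 0) →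
      (∀ j : Fin n, ∀ t : ℝ, 0 ≤ t → 0 ≤ v j t) ∧
      (∀ m : Fin n, ∀ t : ℝ, 0 ≤ t →
        (0 ≤ ∑ j ∈ Finset.univ.filter (fun j : Fin n => j.1 ≤ m.1), v j t) ∧
        ((∑ j ∈ Finset.univ.filter (fun j : Fin n => j.1 ≤ m.1), v j t)
          ≤ ∑ j ∈ Finset.univ.filter (fun j : Fin n => j.1 ≤ m.1), v j 0) ∧
        ((∫ s in (0:ℝ)..t, W m s * v m s)
          ≤ ∑ j ∈ Finset.univ.filter (fun j : Fin n => j.1 ≤ m.1), v j 0))) ∧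
    (∀ m : Fin n, ∀ t : ℝ, 0 ≤ t →
      |∑ j ∈ Finset.univ.filter (fun j : Fin n => j.1 ≤ m.1), v j t|
        ≤ ∑ j ∈ Finset.univ.filter (fun j : Fin n => j.1 ≤ m.1), |v j 0|) := by
  have hII : ∀ j : Fin n, ∀ t : ℝ, 0 ≤ t →
      IntervalIntegrable (fun s => W j s * v j s) MeasureTheory.volume 0 t := by
    intro j t ht
    apply ContinuousOn.intervalIntegrable
    rw [Set.uIcc_of_le ht]
    exact ((hW j).mul (hv j)).mono Set.Icc_subset_Ici_self
  have hstep : ∀ (m : Fin n) (g : Fin n → ℝ),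
      ∑ j ∈ Finset.univ.filter (fun j : Fin n => j.1 ≤ m.1), g j
      = (∑ j ∈ Finset.univ.filter (fun j : Fin n => j.1 < m.1), g j) + g m := by
    intro m g
    have : Finset.univ.filter (fun j : Fin n => j.1 ≤ m.1)
        = insert m (Finset.univ.filter (fun j : Fin n => j.1 < m.1)) := by
      ext j
      simp [Fin.ext_iff]
      omega
    rw [this, Finset.sum_insert (by simp), add_comm]
  have hsucc : ∀ (k : ℕ) (hk : k + 1 < n) (g : Fin n → ℝ),
      ∑ j ∈ Finset.univ.filter (fun j : Fin n => j.1 < k + 1), g j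
      = ∑ j ∈ Finset.univ.filter (fun j : Fin n => j.1 ≤ k), g j := by
    intro k hk g
    simp only [Nat.lt_succ_iff]
  have hS : ∀ (k : ℕ) (hk : k < n) (t : ℝ), 0 ≤ t →
      ∑ j ∈ Finset.univ.filter (fun j : Fin n => j.1 ≤ k), v j t
      = (∑ j ∈ Finset.univ.filter (fun j : Fin n => j.1 ≤ k), v j 0)
        - ∫ s in (0:ℝ)..t, W ⟨k, hk⟩ s * v ⟨k, hk⟩ s := by
    intro k
    induction k with
    | zero =>
      intro hk t ht
      have e1 := hstep ⟨0, hk⟩ (fun j => v j t)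
      have e2 := hstep ⟨0, hk⟩ (fun j => v j 0)
      simp only [Nat.not_lt_zero, Finset.filter_false, Finset.sum_empty, zero_add] at e1 e2
      rw [e1, e2]
      exact hv1 t ht
    | succ k ih =>
      intro hk t ht
      have e1 := hstep ⟨k+1, hk⟩ (fun j => v j t)
      have e2 := hstep ⟨k+1, hk⟩ (fun j => v j 0)
      simp only [] at e1 e2
      rw [hsucc k hk] at e1 e2
      have e3 := ih (by omega) t ht
      have e4 := hvj ⟨k+1, hk⟩ (by simp) t ht
      have e5 : fpred (⟨k+1, hk⟩ : Fin n) = ⟨k, by omega⟩ := by simp [fpred]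
      rw [e5] at e4
      have e6 := intervalIntegral.integral_add (hII ⟨k+1, hk⟩ t ht).neg (hII ⟨k, by omega⟩ t ht)
      simp only [Pi.neg_apply, intervalIntegral.integral_neg] at e6
      rw [e6] at e4
      rw [e1, e2]
      linarith
  refine ⟨fun h0 => ?_, ?_⟩
  · have hpos : ∀ (k : ℕ) (hk : k < n) (t : ℝ), 0 ≤ t → 0 ≤ v ⟨k, hk⟩ t := by
      intro k
      induction k with
      | zero =>
        intro hk
        apply aux_pos (W ⟨0, hk⟩) (fun _ => 0) _ (hW _) continuousOn_const (hv _)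
          (fun _ _ => le_rfl) (h0 _)
        intro t ht
        simp only [add_zero, intervalIntegral.integral_neg]
        rw [← sub_eq_add_neg]
        exact hv1 t ht
      | succ k ih =>
        intro hk
        have e5 : fpred (⟨k+1, hk⟩ : Fin n) = ⟨k, by omega⟩ := by simp [fpred]
        apply aux_pos (W ⟨k+1, hk⟩) (fun s => W ⟨k, by omega⟩ s * v ⟨k, by omega⟩ s) _ (hW _)
          ((hW _).mul (hv _)) (hv _)
          (fun s hs => mul_nonneg (hWpos _ s hs) (ih (by omega) s hs)) (h0 _)
        intro t ht
        have e4 := hvj ⟨k+1, hk⟩ (by simp) t ht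
        rw [e5] at e4
        exact e4
    have hpos' : ∀ j : Fin n, ∀ t : ℝ, 0 ≤ t → 0 ≤ v j t := fun j => hpos j.1 j.2
    refine ⟨hpos', fun m t ht => ?_⟩
    have e1 := hS m.1 m.2 t ht
    have e2 : 0 ≤ ∑ j ∈ Finset.univ.filter (fun j : Fin n => j.1 ≤ m.1), v j t :=
      Finset.sum_nonneg (fun j _ => hpos' j t ht)
    have e3 : 0 ≤ ∫ s in (0:ℝ)..t, W m s * v m s :=
      intervalIntegral.integral_nonneg ht
        (fun s hs => mul_nonneg (hWpos m s hs.1) (hpos' m s hs.1))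
    simp only [Fin.eta] at e1
    exact ⟨e2, by linarith, by linarith⟩
  · have key : ∀ (m : Fin n) (σ : ℝ), |σ| = 1 →
        (∀ t : ℝ, 0 ≤ t → |∑ j ∈ Finset.univ.filter (fun j : Fin n => j.1 < m.1), v j t|
          ≤ ∑ j ∈ Finset.univ.filter (fun j : Fin n => j.1 < m.1), |v j 0|) →
        ∀ t : ℝ, 0 ≤ t →
        0 ≤ (∑ j ∈ Finset.univ.filter (fun j : Fin n => j.1 ≤ m.1), |v j 0|)
          - σ * ∑ j ∈ Finset.univ.filter (fun j : Fin n => j.1 ≤ m.1), v j t := by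
      intro m σ hσ hind
      have hab : ∀ x : ℝ, σ * x ≤ |x| := fun x => by
        calc σ * x ≤ |σ * x| := le_abs_self _
          _ = |x| := by rw [abs_mul, hσ, one_mul]
      apply aux_pos (W m) (fun s => W m s *
        ((∑ j ∈ Finset.univ.filter (fun j : Fin n => j.1 ≤ m.1), |v j 0|)
          - σ * ∑ j ∈ Finset.univ.filter (fun j : Fin n => j.1 < m.1), v j s)) _ (hW m)
      · exact (hW m).mul (continuousOn_const.sub
          (continuousOn_const.mul (continuousOn_finsetSum _ (fun j _ => hv j))))
      · exact continuousOn_const.sub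
          (continuousOn_const.mul (continuousOn_finsetSum _ (fun j _ => hv j)))
      · intro s hs
        apply mul_nonneg (hWpos m s hs)
        have e1 := hstep m (fun j => |v j 0|)
        have e2 := hind s hs
        have e3 := hab (∑ j ∈ Finset.univ.filter (fun j : Fin n => j.1 < m.1), v j s)
        have e4 := abs_nonneg (v m 0)
        beta_reduce at e1
        linarith
      · have e3 := hab (∑ j ∈ Finset.univ.filter (fun j : Fin n => j.1 ≤ m.1), v j 0)
        have e4 := Finset.abs_sum_le_sum_abs (fun j => v j 0)
          (Finset.univ.filter (fun j : Fin n => j.1 ≤ m.1))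
        linarith
      · intro t ht
        have e1 := hS m.1 m.2 t ht
        simp only [Fin.eta] at e1
        have e2 : (∫ s in (0:ℝ)..t, (-(W m s *
            ((∑ j ∈ Finset.univ.filter (fun j : Fin n => j.1 ≤ m.1), |v j 0|)
              - σ * ∑ j ∈ Finset.univ.filter (fun j : Fin n => j.1 ≤ m.1), v j s))
            + W m s * ((∑ j ∈ Finset.univ.filter (fun j : Fin n => j.1 ≤ m.1), |v j 0|)
              - σ * ∑ j ∈ Finset.univ.filter (fun j : Fin n => j.1 < m.1), v j s)))
            = σ * ∫ s in (0:ℝ)..t, W m s * v m s := by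
          rw [← intervalIntegral.integral_const_mul]
          congr 1
          ext s
          rw [hstep m (fun j => v j s)]
          ring
        rw [e2, e1]
        ring
    have main : ∀ (k : ℕ) (hk : k < n) (t : ℝ), 0 ≤ t →
        |∑ j ∈ Finset.univ.filter (fun j : Fin n => j.1 ≤ k), v j t|
        ≤ ∑ j ∈ Finset.univ.filter (fun j : Fin n => j.1 ≤ k), |v j 0| := by
      intro k
      induction k with
      | zero =>
        intro hk t ht
        have p := key ⟨0, hk⟩ 1 (by simp) (by simp) t ht
        have q := key ⟨0, hk⟩ (-1) (by simp) (by simp) t ht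
        simp only [] at p q
        rw [abs_le]
        constructor <;> linarith
      | succ k ih =>
        intro hk t ht
        have hi : ∀ t : ℝ, 0 ≤ t →
            |∑ j ∈ Finset.univ.filter (fun j : Fin n => j.1 < k + 1), v j t|
            ≤ ∑ j ∈ Finset.univ.filter (fun j : Fin n => j.1 < k + 1), |v j 0| := by
          intro t ht
          rw [hsucc k hk, hsucc k hk]
          exact ih (by omega) t ht
        have p := key ⟨k+1, hk⟩ 1 (by simp) hi t ht
        have q := key ⟨k+1, hk⟩ (-1) (by simp) hi t ht
        simp only [] at p q
        rw [abs_le]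
        constructor <;> linarith
    exact fun m => main m.1 m.2
end

section
/- Let n ≥ 1 and let W₁, …, Wₙ : [0, ∞) → [0, ∞) and g₁, …, gₙ : [0, ∞) → [0, ∞) be continuous. Suppose v₁, …, vₙ : [0, ∞) → ℝ are continuous and satisfy v₁(t) = ∫₀ᵗ (-W₁(s)v₁(s) + g₁(s)) ds and v_j(t) = ∫₀ᵗ (-W_j(s)v_j(s) + W_{j-1}(s)v_{j-1}(s) + g_j(s) - g_{j-1}(s)) ds for 2 ≤ j ≤ n and all t ≥ 0 (so v_j(0) = 0 for all j). Then for every m ≤ n and t ≥ 0 one has ∑_{j=1}^m v_j(t) ≥ 0, and the bound -∑_{j=1}^{n-1} ∫₀ᵗ g_j(s) ds ≤ vₙ(t) ≤ ∑_{j=1}^n ∫₀ᵗ g_j(s) ds holds for all t ≥ 0. -/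
lemma core_nonneg (u : ℝ → ℝ) (hu : ContinuousOn u (Set.Ici 0)) (h0 : 0 ≤ u 0)
    (h : ∀ a b : ℝ, 0 ≤ a → a ≤ b → (∀ s ∈ Set.Ioc a b, u s ≤ 0) → u a ≤ u b) :
    ∀ t : ℝ, 0 ≤ t → 0 ≤ u t := by
  intro t ht
  have hsub : Set.Icc 0 t ⊆ Set.Ici (0:ℝ) := fun x hx => hx.1
  have hcl : IsClosed (Set.Icc 0 t ∩ u ⁻¹' (Set.Ici 0)) :=
    (hu.mono hsub).preimage_isClosed_of_isClosed isClosed_Icc isClosed_Ici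
  have hcomp : IsCompact (Set.Icc 0 t ∩ u ⁻¹' (Set.Ici 0)) :=
    isCompact_Icc.of_isClosed_subset hcl Set.inter_subset_left
  obtain ⟨a, ⟨⟨ha0, hat⟩, hua⟩, hmax⟩ := hcomp.exists_isGreatest ⟨0, ⟨le_refl _, ht⟩, h0⟩
  have hua' : 0 ≤ u a := hua
  refine hua'.trans (h a t ha0 hat ?_)
  intro s hs
  by_contra hc
  push Not at hc
  have : s ≤ a := hmax ⟨⟨ha0.trans hs.1.le, hs.2⟩, hc.le⟩
  exact absurd hs.1 (not_lt.2 this)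

lemma core_int (u f : ℝ → ℝ) (hf : ContinuousOn f (Set.Ici 0)) (hu : ContinuousOn u (Set.Ici 0))
    (h : ∀ t : ℝ, 0 ≤ t → u t = ∫ s in (0:ℝ)..t, f s)
    (hp : ∀ s : ℝ, 0 ≤ s → u s ≤ 0 → 0 ≤ f s) :
    ∀ t : ℝ, 0 ≤ t → 0 ≤ u t := by
  have hi : ∀ a b : ℝ, 0 ≤ a → 0 ≤ b → IntervalIntegrable f MeasureTheory.volume a b := by
    intro a b ha hb
    apply ContinuousOn.intervalIntegrable
    exact hf.mono fun x hx => (le_min ha hb).trans hx.1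
  apply core_nonneg u hu
  · rw [h 0 le_rfl]; simp
  · intro a b ha hab hs
    have hb := ha.trans hab
    have e := intervalIntegral.integral_add_adjacent_intervals (hi 0 a le_rfl ha) (hi a b ha hb)
    rw [← h a ha, ← h b hb] at e
    have : 0 ≤ ∫ s in a..b, f s := by
      rw [intervalIntegral.integral_of_le hab]
      apply MeasureTheory.setIntegral_nonneg measurableSet_Ioc
      intro s hs'
      exact hp s (ha.trans hs'.1.le) (hs s hs')
    linarith

lemma nat_version (n : ℕ) (W v g : ℕ → ℝ → ℝ)
    (hW : ∀ j, ContinuousOn (W j) (Set.Ici 0))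
    (hWpos : ∀ j, ∀ s : ℝ, 0 ≤ s → 0 ≤ W j s)
    (hg : ∀ j, ContinuousOn (g j) (Set.Ici 0))
    (hgpos : ∀ j, ∀ s : ℝ, 0 ≤ s → 0 ≤ g j s)
    (hv : ∀ j, ContinuousOn (v j) (Set.Ici 0))
    (hv1 : ∀ t : ℝ, 0 ≤ t → v 0 t = ∫ s in (0:ℝ)..t, (-(W 0 s * v 0 s) + g 0 s))
    (hvj : ∀ j, j + 1 < n → ∀ t : ℝ, 0 ≤ t →
      v (j+1) t = ∫ s in (0:ℝ)..t,
        (-(W (j+1) s * v (j+1) s) + W j s * v j s + g (j+1) s - g j s)) :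
    ∀ k, k ≤ n → 0 < n → ∀ t : ℝ, 0 ≤ t → 0 ≤ ∑ j ∈ Finset.range k, v j t ∧
      ∑ j ∈ Finset.range k, v j t ≤ ∑ j ∈ Finset.range k, ∫ s in (0:ℝ)..t, g j s := by
  have hii : ∀ f : ℝ → ℝ, ContinuousOn f (Set.Ici 0) → ∀ t : ℝ, 0 ≤ t →
      IntervalIntegrable f MeasureTheory.volume 0 t := by
    intro f hf t ht
    apply ContinuousOn.intervalIntegrable
    exact hf.mono fun x hx => (le_min le_rfl ht).trans hx.1
  have hF : ∀ k, ContinuousOn (fun s => -(W k s * v k s) + g k s) (Set.Ici 0) := fun k =>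
    (((hW k).mul (hv k)).neg).add (hg k)
  have hS : ∀ k, k < n → ∀ t : ℝ, 0 ≤ t → ∑ j ∈ Finset.range (k+1), v j t =
      ∫ s in (0:ℝ)..t, (-(W k s * v k s) + g k s) := by
    intro k
    induction k with
    | zero => intro _ t ht; simpa using hv1 t ht
    | succ k ih =>
      intro hk t ht
      rw [Finset.sum_range_succ, ih (by omega) t ht, hvj k hk t ht,
        ← intervalIntegral.integral_add (hii _ (hF k) t ht)]
      · congr 1; ext s; ring
      · apply hii _ _ t ht
        exact (((((hW _).mul (hv _)).neg).add ((hW _).mul (hv _))).add (hg _)).sub (hg _)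
  have hSc : ∀ k, ContinuousOn (fun t => ∑ j ∈ Finset.range k, v j t) (Set.Ici 0) := fun k =>
    continuousOn_finsetSum _ fun j _ => hv j
  have hGc : ∀ k, ContinuousOn (fun t => ∑ j ∈ Finset.range k, g j t) (Set.Ici 0) := fun k =>
    continuousOn_finsetSum _ fun j _ => hg j
  have hGI : ∀ k, ∀ t : ℝ, 0 ≤ t → ∑ j ∈ Finset.range k, ∫ s in (0:ℝ)..t, g j s
      = ∫ s in (0:ℝ)..t, ∑ j ∈ Finset.range k, g j s := by
    intro k t ht
    rw [intervalIntegral.integral_finsetSum]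
    intro j _; exact hii _ (hg j) t ht
  intro k
  induction k with
  | zero => intro _ _ t _; simp
  | succ k ih =>
    intro hk hn
    have ih := ih (by omega) hn
    have A := core_int _ _ (hF k) (hSc (k+1)) (hS k (by omega)) (by
      intro s hs h
      have h1 := (ih s hs).1
      simp only [Finset.sum_range_succ] at h
      have : v k s ≤ 0 := by linarith
      have := mul_nonpos_of_nonneg_of_nonpos (hWpos k s hs) this
      have := hgpos k s hs
      show 0 ≤ -(W k s * v k s) + g k s
      linarith)
    let f : ℝ → ℝ := fun s => ∑ j ∈ Finset.range (k+1), g j s - (-(W k s * v k s) + g k s)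
    have hf : ContinuousOn f (Set.Ici 0) := (hGc (k+1)).sub (hF k)
    have hu : ∀ t : ℝ, 0 ≤ t → (∑ j ∈ Finset.range (k+1), ∫ s in (0:ℝ)..t, g j s)
        - ∑ j ∈ Finset.range (k+1), v j t = ∫ s in (0:ℝ)..t, f s := by
      intro t ht
      rw [hS k (by omega) t ht, hGI _ t ht, ← intervalIntegral.integral_sub
        (hii _ (hGc (k+1)) t ht) (hii _ (hF k) t ht)]
    have hcI : ∀ j, ContinuousOn (fun t => ∫ s in (0:ℝ)..t, g j s) (Set.Ici 0) := by
      intro j t ht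
      have ht : 0 ≤ t := ht
      have h1 : ContinuousOn (fun t => ∫ s in (0:ℝ)..t, g j s) (Set.uIcc 0 (t+1)) :=
        intervalIntegral.continuousOn_primitive_interval (by
          have := (hii _ (hg j) (t+1) (by linarith))
          rw [intervalIntegrable_iff_integrableOn_Icc_of_le (by linarith)] at this
          rwa [Set.uIcc_of_le (by linarith)])
      rw [Set.uIcc_of_le (by linarith)] at h1
      refine (h1 t ⟨ht, by linarith⟩).mono_of_mem_nhdsWithin ?_
      rw [mem_nhdsWithin]
      exact ⟨Set.Iio (t+1), isOpen_Iio, by simp, fun x hx => ⟨hx.2, le_of_lt hx.1⟩⟩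
    have B := core_int _ f hf ((continuousOn_finsetSum _ fun j _ => hcI j).sub (hSc (k+1))) hu (by
      intro s hs h
      have h1 := (ih s hs).2
      simp only [Finset.sum_range_succ, Pi.sub_apply] at h
      have hgi : 0 ≤ ∫ r in (0:ℝ)..s, g k r :=
        intervalIntegral.integral_nonneg hs fun r hr => hgpos k r hr.1
      have : 0 ≤ v k s := by linarith
      have := mul_nonneg (hWpos k s hs) this
      have hg' : 0 ≤ ∑ j ∈ Finset.range k, g j s := Finset.sum_nonneg fun j _ => hgpos j s hs
      simp only [f, Finset.sum_range_succ]
      linarith)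
    intro t ht
    have := B t ht
    exact ⟨A t ht, by simpa using this⟩

lemma fin_sum_lt (n m : ℕ) (hm : m ≤ n) (F : Fin n → ℝ) (f : ℕ → ℝ) (hf : ∀ j : Fin n, f j.1 = F j) :
    ∑ j ∈ Finset.univ.filter (fun j : Fin n => j.1 < m), F j = ∑ k ∈ Finset.range m, f k := by
  refine Finset.sum_bij (fun j _ => j.1) ?_ ?_ ?_ ?_
  · intro a ha; simpa using ha
  · intro a _ b _ h; exact Fin.ext h
  · intro b hb
    have hb := Finset.mem_range.1 hb
    exact ⟨⟨b, by omega⟩, by simpa using hb, rfl⟩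
  · intro a _; exact (hf a).symm

/-- bounds for the triangular linear system whose sources are successive
differences of nonnegative functions, in integral form. -/
theorem stmt_7 (n : ℕ) (hn : 1 ≤ n) (W v g : Fin n → ℝ → ℝ)
    (hW : ∀ j, ContinuousOn (W j) (Set.Ici 0))
    (hWpos : ∀ j, ∀ s : ℝ, 0 ≤ s → 0 ≤ W j s)
    (hg : ∀ j, ContinuousOn (g j) (Set.Ici 0))
    (hgpos : ∀ j, ∀ s : ℝ, 0 ≤ s → 0 ≤ g j s)
    (hv : ∀ j, ContinuousOn (v j) (Set.Ici 0))
    (hv1 : ∀ t : ℝ, 0 ≤ t →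
      v ⟨0, hn⟩ t = ∫ s in (0:ℝ)..t, (-(W ⟨0, hn⟩ s * v ⟨0, hn⟩ s) + g ⟨0, hn⟩ s))
    (hvj : ∀ j : Fin n, j.1 ≠ 0 → ∀ t : ℝ, 0 ≤ t →
      v j t = ∫ s in (0:ℝ)..t,
        (-(W j s * v j s) + W (fpred j) s * v (fpred j) s + g j s - g (fpred j) s)) :
    (∀ m : Fin n, ∀ t : ℝ, 0 ≤ t →
      0 ≤ ∑ j ∈ Finset.univ.filter (fun j : Fin n => j.1 ≤ m.1), v j t) ∧
    (∀ t : ℝ, 0 ≤ t →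
      (-(∑ j ∈ Finset.univ.filter (fun j : Fin n => j.1 < n - 1), ∫ s in (0:ℝ)..t, g j s)
          ≤ v ⟨n - 1, by omega⟩ t) ∧
      v ⟨n - 1, by omega⟩ t ≤ ∑ j : Fin n, ∫ s in (0:ℝ)..t, g j s) := by
  let c : ℕ → Fin n := fun k => ⟨min k (n-1), by omega⟩
  have hc : ∀ j : Fin n, c j.1 = j := fun j => Fin.ext (by have := j.2; simp only [c]; omega)
  have c0 : c 0 = ⟨0, hn⟩ := hc ⟨0, hn⟩
  have key := nat_version n (fun k => W (c k)) (fun k => v (c k)) (fun k => g (c k))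
    (fun _ => hW _) (fun _ => hWpos _) (fun _ => hg _) (fun _ => hgpos _) (fun _ => hv _)
    (by simpa only [c0] using hv1)
    (by
      intro j hj t ht
      have e1 : fpred (c (j+1)) = c j := Fin.ext (by simp only [c, fpred]; omega)
      have := hvj (c (j+1)) (by simp only [c]; omega) t ht
      rwa [e1] at this)
  constructor
  · intro m t ht
    have := (key (m.1+1) m.2 hn t ht).1
    rw [← fin_sum_lt n (m.1+1) m.2 (fun j => v j t) (fun k => v (c k) t)
      (fun j => by simp only [hc])] at this
    simpa only [Nat.lt_succ_iff] using this
  · intro t ht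
    have h1 := key (n-1) (by omega) hn t ht
    have h2 := key (n-1+1) (by omega) hn t ht
    have e1 := fin_sum_lt n (n-1) (by omega) (fun j => ∫ s in (0:ℝ)..t, g j s)
      (fun k => ∫ s in (0:ℝ)..t, g (c k) s) (fun j => by simp only [hc])
    have e2 := fin_sum_lt n (n-1+1) (by omega) (fun j => ∫ s in (0:ℝ)..t, g j s)
      (fun k => ∫ s in (0:ℝ)..t, g (c k) s) (fun j => by simp only [hc])
    rw [Finset.filter_true_of_mem (fun j _ => by have := j.2; omega)] at e2
    have e3 : c (n-1) = ⟨n-1, by omega⟩ := hc ⟨n-1, by omega⟩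
    rw [e1, e2]
    have h3 := Finset.sum_range_succ (fun k => v (c k) t) (n-1)
    rw [e3] at h3
    constructor <;> linarith [h1.1, h1.2, h2.1, h2.2]
end
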